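/- Let 0 < p, q < 1 with q + 2p > 1, and suppose 1 − m^{-q} ≤ a_{m,t} ≤ 1 for all m and all 1 ≤ t ≤ m. Then the null and alternative hypotheses merge asymptotically: TV(P0_m, P1_m) → 0 as m → ∞, so no sequence of tests can reliably separate them. (Theorem 3.2, part 2.) -/

import Mathlib

open MeasureTheory Filter

/-- The uniform distribution on `[0, a]` (for `a > 0`). -/
noncomputable def unif (a : ℝ) : Measure ℝ :=
  (ENNReal.ofReal a)⁻¹ • volume.restrict (Set.Icc 0 a)

/-- The mixture `(1 - ε)·U[0,1] + ε·U[0,a]`. -/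
noncomputable def mix (ε a : ℝ) : Measure ℝ :=
  ENNReal.ofReal (1 - ε) • unif 1 + ENNReal.ofReal ε • unif a

/-- The null law `P0_m`: `m` i.i.d. uniform-`[0,1]` coordinates. -/
noncomputable def nullLaw (m : ℕ) : Measure (Fin m → ℝ) :=
  Measure.pi fun _ => unif 1

/-- The alternative law `P1_m`: independent coordinates, the `t`-th distributed as
`(1 - ε)·U[0,1] + ε·U[0, a t]`. -/
noncomputable def altLaw (m : ℕ) (ε : ℝ) (a : Fin m → ℝ) : Measure (Fin m → ℝ) :=
  Measure.pi fun t => mix ε (a t)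

/-- Total variation distance `sup_A |μ(A) - ν(A)|` over measurable sets. -/
noncomputable def TV {α : Type*} [MeasurableSpace α] (μ ν : Measure α) : ℝ :=
  ⨆ A : {s : Set α // MeasurableSet s}, |(μ A).toReal - (ν A).toReal|

theorem pi_eq_withDensity_prod {ι : Type*} [Fintype ι] {α : ι → Type*}
    [∀ i, MeasurableSpace (α i)] (μ ν : ∀ i, Measure (α i))
    [∀ i, SigmaFinite (μ i)] [∀ i, SigmaFinite (ν i)] (f : ∀ i, α i → ℝ)
    (hf0 : ∀ i x, 0 ≤ f i x) (hfi : ∀ i, Integrable (f i) (μ i))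
    (hν : ∀ i, ν i = (μ i).withDensity fun x => ENNReal.ofReal (f i x)) :
    Measure.pi ν = (Measure.pi μ).withDensity fun x => ENNReal.ofReal (∏ i, f i (x i)) := by
  refine Measure.pi_eq fun s hs => ?_
  have hS : MeasurableSet (Set.univ.pi s) := MeasurableSet.univ_pi hs
  have hint : Integrable (fun x : ∀ i, α i => ∏ i, f i (x i)) (Measure.pi μ) :=
    Integrable.fintype_prod_dep hfi
  have hind : ∀ x, (Set.univ.pi s).indicator (fun x : ∀ i, α i => ∏ i, f i (x i)) x
      = ∏ i, (s i).indicator (f i) (x i) := by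
    intro x
    by_cases hx : x ∈ Set.univ.pi s
    · rw [Set.indicator_of_mem hx]
      exact Finset.prod_congr rfl fun i _ => (Set.indicator_of_mem (hx i trivial) _).symm
    · rw [Set.indicator_of_notMem hx]
      obtain ⟨i, hi⟩ : ∃ i, x i ∉ s i := by simpa [Set.mem_univ_pi] using hx
      exact (Finset.prod_eq_zero (Finset.mem_univ i) (Set.indicator_of_notMem hi _)).symm
  rw [withDensity_apply _ hS, ← ofReal_integral_eq_lintegral_ofReal hint.integrableOn
    (ae_of_all _ fun x => Finset.prod_nonneg fun i _ => hf0 i _), ← integral_indicator hS]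
  simp_rw [hind]
  rw [integral_fintype_prod_eq_prod (fun i => (s i).indicator (f i)),
    ENNReal.ofReal_prod_of_nonneg fun i _ =>
      integral_nonneg fun x => Set.indicator_nonneg (fun x _ => hf0 i x) x]
  refine Finset.prod_congr rfl fun i _ => ?_
  rw [hν i, withDensity_apply _ (hs i), integral_indicator (hs i),
    ofReal_integral_eq_lintegral_ofReal (hfi i).integrableOn (ae_of_all _ (hf0 i))]

theorem TV_nonneg {α : Type*} [MeasurableSpace α] (μ ν : Measure α) : 0 ≤ TV μ ν :=
  Real.iSup_nonneg fun _ => abs_nonneg _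

/-- The total variation distance to a law with density `F` is at most the square root of the
chi-square divergence. -/
theorem TV_withDensity_le_sqrt {Ω : Type*} [MeasurableSpace Ω] (μ : Measure Ω)
    [IsProbabilityMeasure μ] (F : Ω → ℝ) (hF0 : ∀ x, 0 ≤ F x) (hF : MemLp F 2 μ)
    (hF1 : ∫ x, F x ∂μ = 1) :
    TV μ (μ.withDensity fun x => ENNReal.ofReal (F x)) ≤ √(∫ x, F x ^ 2 ∂μ - 1) := by
  have hFi : Integrable F μ := hF.integrable one_le_two
  have hG : MemLp (fun x => 1 - F x) 2 μ := (memLp_const 1).sub hF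
  refine Real.iSup_le (fun ⟨A, hA⟩ => ?_) (Real.sqrt_nonneg _)
  have hdiff : (μ A).toReal - (μ.withDensity (fun x => ENNReal.ofReal (F x)) A).toReal
      = ∫ x, A.indicator (fun x => 1 - F x) x ∂μ := by
    rw [integral_indicator hA, integral_sub (integrable_const _) hFi.integrableOn,
      withDensity_apply _ hA, ← ofReal_integral_eq_lintegral_ofReal hFi.integrableOn
      (ae_of_all _ hF0), ENNReal.toReal_ofReal (integral_nonneg hF0)]
    simp [Measure.real]
  have hvar := ProbabilityTheory.variance_nonneg (A.indicator fun x => 1 - F x) μ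
  rw [ProbabilityTheory.variance_eq_sub (hG.indicator hA)] at hvar
  have hle : ∫ x, ((A.indicator fun x => 1 - F x) ^ 2) x ∂μ ≤ ∫ x, (1 - F x) ^ 2 ∂μ := by
    refine integral_mono (hG.indicator hA).integrable_sq hG.integrable_sq fun x => ?_
    by_cases hx : x ∈ A <;> simp [hx, sq_nonneg]
  have hsq : ∫ x, (1 - F x) ^ 2 ∂μ = ∫ x, F x ^ 2 ∂μ - 1 := by
    have : ∀ x, (1 - F x) ^ 2 = F x ^ 2 - (2 * F x - 1) := fun x => by ring
    simp_rw [this]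
    have hlin : Integrable (fun x => 2 * F x - 1) μ :=
      (hFi.const_mul 2).sub (integrable_const 1)
    rw [integral_sub hF.integrable_sq hlin,
      integral_sub (hFi.const_mul 2) (integrable_const 1), integral_const_mul, hF1]
    norm_num
  rw [hdiff]
  exact Real.abs_le_sqrt (by linarith)

instance isProbabilityMeasure_unif_one : IsProbabilityMeasure (unif 1) := ⟨by simp [unif]⟩

/-- The density of `mix ε a` with respect to `unif 1`. -/
noncomputable def mixDensity (ε a : ℝ) (x : ℝ) : ℝ :=
  (1 - ε) + (Set.Icc 0 a).indicator (fun _ => ε / a) x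

theorem mixDensity_nonneg {ε a : ℝ} (hε0 : 0 ≤ ε) (hε1 : ε ≤ 1) (ha0 : 0 < a) (x : ℝ) :
    0 ≤ mixDensity ε a x :=
  add_nonneg (by linarith) (Set.indicator_nonneg (fun _ _ => by positivity) _)

theorem unif_one_real_Icc {a : ℝ} (ha0 : 0 < a) (ha1 : a ≤ 1) :
    (unif 1).real (Set.Icc 0 a) = a := by
  have : Set.Icc 0 a ∩ Set.Icc 0 1 = Set.Icc 0 a :=
    Set.inter_eq_left.2 (Set.Icc_subset_Icc_right ha1)
  simp [unif, Measure.real, Measure.restrict_apply, this, ha0.le]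

theorem integrable_mixDensity (ε a : ℝ) : Integrable (mixDensity ε a) (unif 1) :=
  (integrable_const _).add ((integrable_const _).indicator measurableSet_Icc)

theorem integral_mixDensity (ε : ℝ) {a : ℝ} (ha0 : 0 < a) (ha1 : a ≤ 1) :
    ∫ x, mixDensity ε a x ∂unif 1 = 1 := by
  unfold mixDensity
  rw [integral_add (integrable_const _) ((integrable_const _).indicator measurableSet_Icc),
    integral_indicator_const _ measurableSet_Icc, unif_one_real_Icc ha0 ha1]
  simp
  field_simp
  ring

theorem mixDensity_sq (ε a x : ℝ) : mixDensity ε a x ^ 2 =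
    (1 - ε) ^ 2 + (Set.Icc 0 a).indicator (fun _ => 2 * (1 - ε) * (ε / a) + (ε / a) ^ 2) x := by
  by_cases hx : x ∈ Set.Icc 0 a
  · simp only [mixDensity, Set.indicator_of_mem hx]; ring
  · simp [mixDensity, Set.indicator_of_notMem hx]

theorem integrable_mixDensity_sq (ε a : ℝ) :
    Integrable (fun x => mixDensity ε a x ^ 2) (unif 1) := by
  simp_rw [mixDensity_sq]
  exact (integrable_const _).add ((integrable_const _).indicator measurableSet_Icc)

theorem integral_mixDensity_sq (ε : ℝ) {a : ℝ} (ha0 : 0 < a) (ha1 : a ≤ 1) :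
    ∫ x, mixDensity ε a x ^ 2 ∂unif 1 = 1 + ε ^ 2 * (1 / a - 1) := by
  simp_rw [mixDensity_sq]
  rw [integral_add (integrable_const _) ((integrable_const _).indicator measurableSet_Icc),
    integral_indicator_const _ measurableSet_Icc, unif_one_real_Icc ha0 ha1]
  simp
  field_simp
  ring

theorem mix_eq_withDensity {ε a : ℝ} (hε0 : 0 ≤ ε) (hε1 : ε ≤ 1) (ha0 : 0 < a) (ha1 : a ≤ 1) :
    mix ε a = (unif 1).withDensity fun x => ENNReal.ofReal (mixDensity ε a x) := by
  have hsplit : (fun x => ENNReal.ofReal (mixDensity ε a x)) =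
      (fun _ => ENNReal.ofReal (1 - ε)) +
        (Set.Icc 0 a).indicator (fun _ => ENNReal.ofReal (ε / a)) := by
    funext x
    by_cases hx : x ∈ Set.Icc 0 a
    · simp only [mixDensity, Pi.add_apply, Set.indicator_of_mem hx]
      exact ENNReal.ofReal_add (by linarith) (by positivity)
    · simp [mixDensity, Set.indicator_of_notMem hx]
  have hrestr : (unif 1).restrict (Set.Icc 0 a) = volume.restrict (Set.Icc 0 a) := by
    simp [unif, Measure.restrict_restrict measurableSet_Icc,
      Set.inter_eq_left.2 (Set.Icc_subset_Icc_right ha1 : Set.Icc 0 a ⊆ Set.Icc 0 1)]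
  rw [hsplit, withDensity_add_left measurable_const, withDensity_const,
    withDensity_indicator measurableSet_Icc, withDensity_const, hrestr, mix,
    ENNReal.ofReal_div_of_pos ha0, div_eq_mul_inv, mul_smul]
  rfl

theorem TV_nullLaw_altLaw_le {m : ℕ} {ε : ℝ} {a : Fin m → ℝ} (hε0 : 0 ≤ ε) (hε1 : ε ≤ 1)
    (ha0 : ∀ t, 0 < a t) (ha1 : ∀ t, a t ≤ 1) :
    TV (nullLaw m) (altLaw m ε a) ≤ √(Real.exp (∑ t, ε ^ 2 * (1 / a t - 1)) - 1) := by
  have hmix := fun t => mix_eq_withDensity hε0 hε1 (ha0 t) (ha1 t)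
  have hsf : ∀ t, SigmaFinite (mix ε (a t)) := fun t => by
    rw [hmix t]
    exact SigmaFinite.withDensity_ofReal _
  have hint : Integrable (fun x : Fin m → ℝ => ∏ t, mixDensity ε (a t) (x t))
      (Measure.pi fun _ => unif 1) :=
    Integrable.fintype_prod_dep fun t => integrable_mixDensity ε (a t)
  have hsq : Integrable (fun x : Fin m → ℝ => (∏ t, mixDensity ε (a t) (x t)) ^ 2)
      (Measure.pi fun _ => unif 1) := by
    simp_rw [← Finset.prod_pow]
    exact Integrable.fintype_prod_dep (f := fun t x => mixDensity ε (a t) x ^ 2)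
      fun t => integrable_mixDensity_sq ε (a t)
  rw [nullLaw, altLaw, pi_eq_withDensity_prod _ _ (fun t => mixDensity ε (a t))
    (fun t => mixDensity_nonneg hε0 hε1 (ha0 t)) (fun t => integrable_mixDensity ε (a t)) hmix]
  refine (TV_withDensity_le_sqrt _ _
    (fun x => Finset.prod_nonneg fun t _ => mixDensity_nonneg hε0 hε1 (ha0 t) _)
    ((memLp_two_iff_integrable_sq hint.aestronglyMeasurable).2 hsq) ?_).trans ?_
  · rw [integral_fintype_prod_eq_prod (fun t => mixDensity ε (a t))]
    exact Finset.prod_eq_one fun t _ => integral_mixDensity ε (ha0 t) (ha1 t)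
  · simp_rw [← Finset.prod_pow]
    rw [integral_fintype_prod_eq_prod (fun t x => mixDensity ε (a t) x ^ 2)]
    simp_rw [fun t => integral_mixDensity_sq ε (ha0 t) (ha1 t)]
    gcongr
    refine Real.prod_one_add_le_exp_sum _ fun t => ?_
    have : 1 ≤ 1 / a t := (one_le_div (ha0 t)).2 (ha1 t)
    exact mul_nonneg (sq_nonneg _) (by linarith)

/-- **Theorem 3.2, part 2.** Let `0 < p, q < 1` with `q + 2p > 1`, `ε_m = m^{-p}`, and
`1 - m^{-q} ≤ a m t ≤ 1` for all `m ≥ 2`, `1 ≤ t ≤ m`.  Then the null and alternative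
hypotheses merge asymptotically: `TV(P0_m, P1_m) → 0` as `m → ∞`, so no sequence of tests
can reliably separate them. -/
theorem asymptotic_merging (p q : ℝ) (hp0 : 0 < p) (hp1 : p < 1)
    (hq0 : 0 < q) (hq1 : q < 1) (hpq : q + 2 * p > 1)
    (a : (m : ℕ) → Fin m → ℝ)
    (ha0 : ∀ m : ℕ, 2 ≤ m → ∀ t, 1 - (m : ℝ) ^ (-q) ≤ a m t)
    (ha1 : ∀ m, 2 ≤ m → ∀ t, a m t ≤ 1) :
    Tendsto (fun m => TV (nullLaw m) (altLaw m ((m : ℝ) ^ (-p)) (a m))) atTop (nhds 0) := by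
  have hlim : Tendsto (fun m : ℕ => √(Real.exp (2 * (m : ℝ) ^ (-(q + 2 * p - 1))) - 1))
      atTop (nhds 0) := by
    have h := (tendsto_rpow_neg_atTop (show 0 < q + 2 * p - 1 by linarith)).comp
      tendsto_natCast_atTop_atTop
    have hc : Continuous fun y : ℝ => √(Real.exp (2 * y) - 1) := by fun_prop
    simpa [Function.comp_def] using (hc.tendsto 0).comp h
  have hsmall : ∀ᶠ m : ℕ in atTop, (m : ℝ) ^ (-q) ≤ 1 / 2 :=
    ((tendsto_rpow_neg_atTop hq0).comp tendsto_natCast_atTop_atTop).eventually_le_const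
      (by norm_num)
  refine squeeze_zero' (Eventually.of_forall fun m => TV_nonneg _ _) ?_ hlim
  filter_upwards [hsmall, eventually_ge_atTop 2] with m hm hm2
  have hm1 : (1 : ℝ) ≤ m := by exact_mod_cast one_le_two.trans hm2
  have hmpos : (0 : ℝ) < m := by linarith
  have hhalf : ∀ t, 1 / 2 ≤ a m t := fun t => by linarith [ha0 m hm2 t]
  refine (TV_nullLaw_altLaw_le (by positivity)
    (Real.rpow_le_one_of_one_le_of_nonpos hm1 (by linarith))
    (fun t => by linarith [hhalf t]) (ha1 m hm2)).trans ?_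
  gcongr
  have hterm : ∀ t, 1 / a m t - 1 ≤ 2 * (m : ℝ) ^ (-q) := fun t => by
    have hpos : 0 < a m t := by linarith [hhalf t]
    rw [sub_le_iff_le_add, div_le_iff₀ hpos]
    nlinarith [hhalf t, ha0 m hm2 t, Real.rpow_pos_of_pos hmpos (-q)]
  calc ∑ t, ((m : ℝ) ^ (-p)) ^ 2 * (1 / a m t - 1)
      ≤ ∑ _t : Fin m, ((m : ℝ) ^ (-p)) ^ 2 * (2 * (m : ℝ) ^ (-q)) := by
        gcongr with t
        exact hterm t
    _ = 2 * ((m : ℝ) ^ (1 : ℝ) * ((m : ℝ) ^ (-p) * (m : ℝ) ^ (-p)) * (m : ℝ) ^ (-q)) := by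
        simp
        ring
    _ = 2 * (m : ℝ) ^ (-(q + 2 * p - 1)) := by
        rw [← Real.rpow_add hmpos, ← Real.rpow_add hmpos, ← Real.rpow_add hmpos]
        ring_nf
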